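/- Let a ∈ [2, ∞) be a real number and let a* = a/(a−1) be its conjugate index. Then for every positive integer N and every bilinear form A : ℝ^N × ℝ^N → ℝ, one has (∑_{k=1}^N (∑_{j=1}^N |A(e_k, e_j)|^a)^{a*/a})^{1/a*} ≤ ‖A‖. -/

import Mathlib

open Finset

/-- The supremum norm of a bilinear form on `ℝ^N × ℝ^N` over the unit polydisc. -/
noncomputable def bilinNorm (N : ℕ) (A : (Fin N → ℝ) →ₗ[ℝ] (Fin N → ℝ) →ₗ[ℝ] ℝ) : ℝ :=
  sSup { t : ℝ | ∃ x y : Fin N → ℝ, (∀ i, |x i| ≤ 1) ∧ (∀ j, |y j| ≤ 1) ∧ t = |A x y| }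

/-- Real value of a sign vector. -/
noncomputable def sgnVec {N : ℕ} (e : Fin N → ℤˣ) : Fin N → ℝ := fun i => ((e i : ℤ) : ℝ)

lemma sgnVec_abs {N : ℕ} (e : Fin N → ℤˣ) (i : Fin N) : |sgnVec e i| = 1 := by
  rcases Int.units_eq_one_or (e i) with h | h <;> simp [sgnVec, h]

lemma sgn_orth {N : ℕ} (i j : Fin N) :
    ∑ e : Fin N → ℤˣ, sgnVec e i * sgnVec e j
      = if i = j then (Fintype.card (Fin N → ℤˣ) : ℝ) else 0 := by
  split_ifs with h
  · subst h
    have : ∀ e : Fin N → ℤˣ, sgnVec e i * sgnVec e i = 1 := by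
      intro e
      rw [← abs_mul_abs_self, sgnVec_abs]; norm_num
    simp [this]
  · have h1 := Equiv.sum_comp (Equiv.mulLeft (Function.update (1 : Fin N → ℤˣ) i (-1)))
      (fun e : Fin N → ℤˣ => sgnVec e i * sgnVec e j)
    have h2 : ∀ e : Fin N → ℤˣ,
        sgnVec (Equiv.mulLeft (Function.update (1 : Fin N → ℤˣ) i (-1)) e) i *
        sgnVec (Equiv.mulLeft (Function.update (1 : Fin N → ℤˣ) i (-1)) e) j
        = - (sgnVec e i * sgnVec e j) := by
      intro e
      have : j ≠ i := fun h' => h h'.symm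
      simp [sgnVec, Function.update_of_ne this]
    simp only [h2, Finset.sum_neg_distrib] at h1
    linarith

lemma core (a : ℝ) (ha : 2 ≤ a) (N : ℕ) (c : Fin N → Fin N → ℝ) (m : Fin N → ℝ) (M : ℝ)
    (hM : 0 < M) (hm : ∀ k j, |c k j| ≤ m k) (hm0 : ∀ k, 0 ≤ m k) (hsm : ∑ k, m k ≤ M)
    (hs : ∑ k, ∑ j, (c k j) ^ 2 ≤ M ^ 2) :
    (∑ k : Fin N, (∑ j : Fin N, |c k j| ^ a) ^ ((a / (a - 1)) / a)) ^ (1 / (a / (a - 1))) ≤ M := by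
  have ha1 : 0 < a - 1 := by linarith
  have ha0 : 0 < a := by linarith
  have hβ : (a / (a - 1)) / a = 1 / (a - 1) := by field_simp
  rw [hβ]
  set β := 1 / (a - 1) with hβd
  have hβ0 : 0 < β := by positivity
  have hαβ : (a - 2) * β + β = 1 := by rw [hβd]; field_simp; ring
  have hα0 : 0 ≤ (a - 2) * β := mul_nonneg (by linarith) hβ0.le
  have hs0 : ∀ k, 0 ≤ ∑ j, (c k j) ^ 2 := fun k => Finset.sum_nonneg fun j _ => sq_nonneg _
  have key : ∀ k, (∑ j : Fin N, |c k j| ^ a) ^ β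
      ≤ M ^ (a * β) * ((a - 2) * β * (m k / M) + β * ((∑ j, (c k j) ^ 2) / M ^ 2)) := by
    intro k
    have h1 : ∑ j : Fin N, |c k j| ^ a ≤ (m k) ^ (a - 2) * ∑ j, (c k j) ^ 2 := by
      rw [Finset.mul_sum]
      refine Finset.sum_le_sum fun j _ => ?_
      have : |c k j| ^ a = |c k j| ^ (a - 2) * (c k j) ^ 2 := by
        rw [← sq_abs (c k j), ← Real.rpow_natCast, ← Real.rpow_add_of_nonneg (abs_nonneg _)
          (by linarith) (by norm_num)]
        norm_num
      rw [this]
      exact mul_le_mul_of_nonneg_right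
        (Real.rpow_le_rpow (abs_nonneg _) (hm k j) (by linarith)) (sq_nonneg _)
    have hu : 0 ≤ m k / M := div_nonneg (hm0 k) hM.le
    have hv : 0 ≤ (∑ j, (c k j) ^ 2) / M ^ 2 := div_nonneg (hs0 k) (by positivity)
    have h2 := Real.geom_mean_le_arith_mean2_weighted hα0 hβ0.le hu hv hαβ
    calc (∑ j : Fin N, |c k j| ^ a) ^ β ≤ ((m k) ^ (a - 2) * ∑ j, (c k j) ^ 2) ^ β :=
          Real.rpow_le_rpow (Finset.sum_nonneg fun j _ => by positivity) h1 hβ0.le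
      _ = M ^ (a * β) * ((m k / M) ^ ((a - 2) * β) * ((∑ j, (c k j) ^ 2) / M ^ 2) ^ β) := by
          rw [Real.mul_rpow (Real.rpow_nonneg (hm0 k) _) (hs0 k), ← Real.rpow_mul (hm0 k),
            Real.div_rpow (hm0 k) hM.le, Real.div_rpow (hs0 k) (by positivity),
            ← Real.rpow_natCast M 2, ← Real.rpow_mul hM.le]
          have : M ^ (a * β) = M ^ ((a - 2) * β) * M ^ (((2 : ℕ) : ℝ) * β) := by
            rw [← Real.rpow_add hM]; congr 1; push_cast; ring
          rw [this]
          have h3 : 0 < M ^ ((a - 2) * β) := Real.rpow_pos_of_pos hM _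
          have h4 : 0 < M ^ (((2 : ℕ) : ℝ) * β) := Real.rpow_pos_of_pos hM _
          field_simp
      _ ≤ _ := mul_le_mul_of_nonneg_left h2 (by positivity)
  have hsum : ∑ k : Fin N, (∑ j : Fin N, |c k j| ^ a) ^ β ≤ M ^ (a * β) := by
    refine (Finset.sum_le_sum fun k _ => key k).trans ?_
    rw [← Finset.mul_sum, Finset.sum_add_distrib, ← Finset.mul_sum, ← Finset.mul_sum,
      ← Finset.sum_div, ← Finset.sum_div]
    have h1 : (∑ k, m k) / M ≤ 1 := (div_le_one hM).2 hsm
    have h2 : (∑ k, ∑ j, (c k j) ^ 2) / M ^ 2 ≤ 1 := (div_le_one (by positivity)).2 hs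
    have h3 : 0 ≤ M ^ (a * β) := by positivity
    have h4 := mul_le_mul_of_nonneg_left h1 hα0
    have h5 := mul_le_mul_of_nonneg_left h2 hβ0.le
    exact mul_le_of_le_one_right h3 (by linarith)
  calc _ ≤ (M ^ (a * β)) ^ (1 / (a / (a - 1))) :=
        Real.rpow_le_rpow (Finset.sum_nonneg fun k _ => Real.rpow_nonneg
          (Finset.sum_nonneg fun j _ => by positivity) _) hsum (by positivity)
    _ = M := by
        rw [← Real.rpow_mul hM.le]
        have : a * β * (1 / (a / (a - 1))) = 1 := by rw [hβd]; field_simp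
        rw [this, Real.rpow_one]

lemma bilin_expand (N : ℕ) (A : (Fin N → ℝ) →ₗ[ℝ] (Fin N → ℝ) →ₗ[ℝ] ℝ) (x y : Fin N → ℝ) :
    A x y = ∑ k, x k * ∑ j, A (Pi.single k 1) (Pi.single j 1) * y j := by
  have hx : ∀ z : Fin N → ℝ, z = ∑ k, z k • (Pi.single k 1 : Fin N → ℝ) := fun z =>
    pi_eq_sum_univ' z |>.trans (by
      refine Finset.sum_congr rfl fun k _ => ?_
      congr 1)
  conv_lhs => rw [hx x, hx y]
  simp only [map_sum, map_smul, LinearMap.sum_apply, LinearMap.smul_apply, smul_eq_mul,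
    Finset.mul_sum]
  rw [Finset.sum_comm]
  refine Finset.sum_congr rfl fun k _ => Finset.sum_congr rfl fun j _ => ?_
  ring

lemma abs_sum_le_norm (N : ℕ) (A : (Fin N → ℝ) →ₗ[ℝ] (Fin N → ℝ) →ₗ[ℝ] ℝ) (y : Fin N → ℝ)
    (hy : ∀ j, |y j| ≤ 1) :
    ∑ k, |∑ j, A (Pi.single k 1) (Pi.single j 1) * y j| ≤ bilinNorm N A := by
  unfold bilinNorm
  refine le_csSup ⟨∑ k, ∑ j, |A (Pi.single k 1) (Pi.single j 1)|, ?_⟩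
    ⟨fun k => SignType.sign (∑ j, A (Pi.single k 1) (Pi.single j 1) * y j), y, ?_, hy, ?_⟩
  · rintro t ⟨x, y, hx, hy, rfl⟩
    rw [bilin_expand]
    refine (Finset.abs_sum_le_sum_abs _ _).trans (Finset.sum_le_sum fun k _ => ?_)
    rw [abs_mul]
    refine (mul_le_of_le_one_left (abs_nonneg _) (hx k)).trans ?_
    refine (Finset.abs_sum_le_sum_abs _ _).trans (Finset.sum_le_sum fun j _ => ?_)
    rw [abs_mul]
    exact mul_le_of_le_one_right (abs_nonneg _) (hy j)
  · intro k
    have hs : ∀ s : SignType, |(s : ℝ)| ≤ 1 := by intro s; cases s <;> simp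
    exact hs _
  · rw [bilin_expand]
    simp only [sign_mul_self]
    rw [abs_of_nonneg (Finset.sum_nonneg fun k _ => abs_nonneg _)]

theorem real_mixed_conjugate (a : ℝ) (ha : 2 ≤ a) (N : ℕ) (hN : 0 < N)
    (A : (Fin N → ℝ) →ₗ[ℝ] (Fin N → ℝ) →ₗ[ℝ] ℝ) :
    (∑ k : Fin N,
        (∑ j : Fin N, |A (Pi.single k 1) (Pi.single j 1)| ^ a) ^ ((a / (a - 1)) / a))
        ^ (1 / (a / (a - 1)))
      ≤ bilinNorm N A := by
  have hb := abs_sum_le_norm N A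
  have hB0 : 0 ≤ bilinNorm N A :=
    (Finset.sum_nonneg fun k _ => abs_nonneg _).trans (hb 0 (by simp))
  generalize bilinNorm N A = B at hb hB0 ⊢
  obtain ⟨c, hc⟩ : ∃ c : Fin N → Fin N → ℝ,
    ∀ k j, A (Pi.single k 1) (Pi.single j 1) = c k j := ⟨_, fun _ _ => rfl⟩
  simp only [hc] at hb ⊢
  set K : ℝ := (Fintype.card (Fin N → ℤˣ) : ℝ) with hK
  have hK0 : 0 < K := by rw [hK]; exact_mod_cast Fintype.card_pos
  have hs1 : ∀ e : Fin N → ℤˣ, ∑ k, |∑ j, c k j * sgnVec e j| ≤ B :=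
    fun e => hb _ fun j => (sgnVec_abs e j).le
  have hcard : ∀ t : ℝ, ∑ _e : Fin N → ℤˣ, t = K * t := by intro t; simp [hK]
  have orth : ∀ k i, ∑ e : Fin N → ℤˣ, (∑ j, c k j * sgnVec e j) * sgnVec e i = K * c k i := by
    intro k i
    simp only [Finset.sum_mul, mul_assoc]
    rw [Finset.sum_comm]
    simp only [← Finset.mul_sum, sgn_orth]
    simp [hK, mul_comm]
  refine le_of_forall_gt_imp_ge_of_dense fun M hBM => ?_
  refine core a ha N c (fun k => (∑ e : Fin N → ℤˣ, |∑ j, c k j * sgnVec e j|) / K) M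
    (hB0.trans_lt hBM) ?_ ?_ ?_ ?_
  · intro k i
    rw [le_div_iff₀ hK0, ← abs_of_pos hK0, ← abs_mul, mul_comm, ← orth]
    refine (Finset.abs_sum_le_sum_abs _ _).trans (Finset.sum_le_sum fun e _ => ?_)
    rw [abs_mul, sgnVec_abs, mul_one]
  · intro k
    exact div_nonneg (Finset.sum_nonneg fun e _ => abs_nonneg _) hK0.le
  · rw [← Finset.sum_div (Finset.univ : Finset (Fin N))
      (fun k => ∑ e : Fin N → ℤˣ, |∑ j, c k j * sgnVec e j|) K, Finset.sum_comm, div_le_iff₀ hK0, mul_comm, ← hcard]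
    exact Finset.sum_le_sum fun e _ => (hs1 e).trans hBM.le
  · have h1 : K * ∑ k, ∑ j, (c k j) ^ 2
        = ∑ e : Fin N → ℤˣ, ∑ k, (∑ j, c k j * sgnVec e j) ^ 2 := by
      rw [Finset.mul_sum]
      conv_rhs => rw [Finset.sum_comm]
      refine Finset.sum_congr rfl fun k _ => ?_
      have h2 : ∀ e : Fin N → ℤˣ, (∑ j, c k j * sgnVec e j) ^ 2
          = ∑ i, c k i * ((∑ j, c k j * sgnVec e j) * sgnVec e i) := by
        intro e
        rw [sq]
        conv_lhs => rw [Finset.mul_sum]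
        exact Finset.sum_congr rfl fun i _ => by ring
      simp only [h2]
      rw [Finset.sum_comm, Finset.mul_sum]
      refine Finset.sum_congr rfl fun i _ => ?_
      rw [← Finset.mul_sum, orth]; ring
    have h3 : K * ∑ k, ∑ j, (c k j) ^ 2 ≤ K * M ^ 2 := by
      rw [h1, ← hcard]
      refine Finset.sum_le_sum fun e _ => ?_
      have h4 : ∑ k, (∑ j, c k j * sgnVec e j) ^ 2 ≤ (∑ k, |∑ j, c k j * sgnVec e j|) ^ 2 := by
        simp only [← sq_abs (∑ j, c _ j * sgnVec e j)]
        exact Finset.sum_sq_le_sq_sum_of_nonneg fun k _ => abs_nonneg _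
      exact h4.trans (pow_le_pow_left₀ (Finset.sum_nonneg fun k _ => abs_nonneg _)
        ((hs1 e).trans hBM.le) 2)
    exact le_of_mul_le_mul_left h3 hK0
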